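/- arXiv:2407.11904 — 4 statements merged into one kernel-verified Lean document; each statement's English description precedes it below -/
import Mathlib

section
/- Let E be a real normed vector space and t₀ < t₁ real numbers. Let Q : E → ℝ have Fréchet derivative Q'(x) ∈ E →L[ℝ] ℝ at every x ∈ E, and let u : ℝ → E be differentiable with derivative u', such that t ↦ Q'(u(t))(u'(t)) is continuous on [t₀, t₁]. Let M : E → E → E → ℝ, let F̃ : ℝ → E → ℝ, let w̃ : ℝ → E, let V be a set of functions ℝ → E with u' ∈ V and w̃ ∈ V, and let I be a linear functional on real-valued functions of time. Assume (i) for all v ∈ V, I[t ↦ M(u(t))(u'(t))(v(t))] = I[t ↦ F̃(t)(v(t))] (the discrete scheme), and (ii) for all v ∈ V, I[t ↦ M(u(t))(v(t))(w̃(t))] = ∫_{t₀}^{t₁} Q'(u(t))(v(t)) dt (the auxiliary-variable definition). Then Q(u(t₁)) − Q(u(t₀)) = I[t ↦ F̃(t)(w̃(t))]. -/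
open MeasureTheory

theorem stmt_0
    {E : Type*} [NormedAddCommGroup E] [NormedSpace ℝ E]
    (t₀ t₁ : ℝ) (ht : t₀ < t₁)
    (Q : E → ℝ) (Q' : E → (E →L[ℝ] ℝ))
    (hQ : ∀ x : E, HasFDerivAt Q (Q' x) x)
    (u u' : ℝ → E) (hu : ∀ t : ℝ, HasDerivAt u (u' t) t)
    (hcont : ContinuousOn (fun t => Q' (u t) (u' t)) (Set.Icc t₀ t₁))
    (M : E → E → E → ℝ) (F' : ℝ → E → ℝ) (w' : ℝ → E)
    (V : Set (ℝ → E)) (hu'V : u' ∈ V) (hw'V : w' ∈ V)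
    (I : (ℝ → ℝ) →ₗ[ℝ] ℝ)
    (hscheme : ∀ v ∈ V,
      I (fun t => M (u t) (u' t) (v t)) = I (fun t => F' t (v t)))
    (haux : ∀ v ∈ V,
      I (fun t => M (u t) (v t) (w' t)) = ∫ t in t₀..t₁, Q' (u t) (v t)) :
    Q (u t₁) - Q (u t₀) = I (fun t => F' t (w' t)) := by
  rw [← hscheme w' hw'V, haux u' hu'V]
  refine (intervalIntegral.integral_eq_sub_of_hasDerivAt (f := fun t => Q (u t))
    (fun t _ => (hQ (u t)).comp_hasDerivAt t (hu t)) ?_).symm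
  exact hcont.intervalIntegrable_of_Icc ht.le
end

section
/- Let E be a real normed vector space and t₀ < t₁ real numbers. Let Q : E → ℝ have Fréchet derivative Q'(x) ∈ E →L[ℝ] ℝ at every x ∈ E, and let u : ℝ → E be differentiable with derivative u', such that t ↦ Q'(u(t))(u'(t)) is continuous on [t₀, t₁]. Let M : E → E → E → ℝ, let F̃ : ℝ → E → ℝ, let w̃ : ℝ → E, let V be a set of functions ℝ → E with u' ∈ V and w̃ ∈ V, and let I be a linear functional on real-valued functions of time that is sign-preserving on [t₀, t₁] (if φ(t) ≥ 0 for all t ∈ [t₀, t₁] then I[φ] ≥ 0). Assume (i) for all v ∈ V, I[t ↦ M(u(t))(u'(t))(v(t))] = I[t ↦ F̃(t)(v(t))], (ii) for all v ∈ V, I[t ↦ M(u(t))(v(t))(w̃(t))] = ∫_{t₀}^{t₁} Q'(u(t))(v(t)) dt, and (iii) F̃(t)(w̃(t)) = 0 for all t ∈ [t₀, t₁]. Then Q(u(t₁)) = Q(u(t₀)). -/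
open MeasureTheory

theorem stmt_1
    {E : Type*} [NormedAddCommGroup E] [NormedSpace ℝ E]
    (t₀ t₁ : ℝ) (ht : t₀ < t₁)
    (Q : E → ℝ) (Q' : E → (E →L[ℝ] ℝ))
    (hQ : ∀ x : E, HasFDerivAt Q (Q' x) x)
    (u u' : ℝ → E) (hu : ∀ t : ℝ, HasDerivAt u (u' t) t)
    (hcont : ContinuousOn (fun t => Q' (u t) (u' t)) (Set.Icc t₀ t₁))
    (M : E → E → E → ℝ) (F' : ℝ → E → ℝ) (w' : ℝ → E)
    (V : Set (ℝ → E)) (hu'V : u' ∈ V) (hw'V : w' ∈ V)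
    (I : (ℝ → ℝ) →ₗ[ℝ] ℝ)
    (hsign : ∀ φ : ℝ → ℝ, (∀ t ∈ Set.Icc t₀ t₁, 0 ≤ φ t) → 0 ≤ I φ)
    (hscheme : ∀ v ∈ V,
      I (fun t => M (u t) (u' t) (v t)) = I (fun t => F' t (v t)))
    (haux : ∀ v ∈ V,
      I (fun t => M (u t) (v t) (w' t)) = ∫ t in t₀..t₁, Q' (u t) (v t))
    (hF : ∀ t ∈ Set.Icc t₀ t₁, F' t (w' t) = 0) :
    Q (u t₁) = Q (u t₀) := by
  have hftc : ∫ t in t₀..t₁, Q' (u t) (u' t) = Q (u t₁) - Q (u t₀) :=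
    intervalIntegral.integral_eq_sub_of_hasDerivAt
      (fun t _ => (hQ (u t)).comp_hasDerivAt t (hu t))
      (hcont.intervalIntegrable_of_Icc ht.le)
  have hnonneg : 0 ≤ I (fun t => F' t (w' t)) := hsign _ fun t h => (hF t h).ge
  have hnonpos : 0 ≤ I (-fun t => F' t (w' t)) :=
    hsign _ fun t h => by simp [hF t h]
  rw [map_neg] at hnonpos
  linarith [hscheme w' hw'V, haux u' hu'V]
end

section
/- Let E be a real normed vector space and t₀ < t₁ real numbers. Let Q : E → ℝ have Fréchet derivative Q'(x) ∈ E →L[ℝ] ℝ at every x ∈ E, and let u : ℝ → E be differentiable with derivative u', such that t ↦ Q'(u(t))(u'(t)) is continuous on [t₀, t₁]. Let M : E → E → E → ℝ, let F̃ : ℝ → E → ℝ, let w̃ : ℝ → E, let V be a set of functions ℝ → E with u' ∈ V and w̃ ∈ V, and let I be a linear functional on real-valued functions of time that is sign-preserving on [t₀, t₁] (if φ(t) ≥ 0 for all t ∈ [t₀, t₁] then I[φ] ≥ 0). Assume (i) for all v ∈ V, I[t ↦ M(u(t))(u'(t))(v(t))] = I[t ↦ F̃(t)(v(t))], (ii)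 for all v ∈ V, I[t ↦ M(u(t))(v(t))(w̃(t))] = ∫_{t₀}^{t₁} Q'(u(t))(v(t)) dt, and (iii) F̃(t)(w̃(t)) ≤ 0 for all t ∈ [t₀, t₁]. Then Q(u(t₁)) ≤ Q(u(t₀)). -/
open MeasureTheory

theorem stmt_2
    {E : Type*} [NormedAddCommGroup E] [NormedSpace ℝ E]
    (t₀ t₁ : ℝ) (ht : t₀ < t₁)
    (Q : E → ℝ) (Q' : E → (E →L[ℝ] ℝ))
    (hQ : ∀ x : E, HasFDerivAt Q (Q' x) x)
    (u u' : ℝ → E) (hu : ∀ t : ℝ, HasDerivAt u (u' t) t)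
    (hcont : ContinuousOn (fun t => Q' (u t) (u' t)) (Set.Icc t₀ t₁))
    (M : E → E → E → ℝ) (F' : ℝ → E → ℝ) (w' : ℝ → E)
    (V : Set (ℝ → E)) (hu'V : u' ∈ V) (hw'V : w' ∈ V)
    (I : (ℝ → ℝ) →ₗ[ℝ] ℝ)
    (hsign : ∀ φ : ℝ → ℝ, (∀ t ∈ Set.Icc t₀ t₁, 0 ≤ φ t) → 0 ≤ I φ)
    (hscheme : ∀ v ∈ V,
      I (fun t => M (u t) (u' t) (v t)) = I (fun t => F' t (v t)))
    (haux : ∀ v ∈ V,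
      I (fun t => M (u t) (v t) (w' t)) = ∫ t in t₀..t₁, Q' (u t) (v t))
    (hF : ∀ t ∈ Set.Icc t₀ t₁, F' t (w' t) ≤ 0) :
    Q (u t₁) ≤ Q (u t₀) := by
  have hderiv : ∀ t ∈ Set.uIcc t₀ t₁,
      HasDerivAt (fun t => Q (u t)) (Q' (u t) (u' t)) t :=
    fun t _ => (hQ (u t)).comp_hasDerivAt t (hu t)
  have hint : IntervalIntegrable (fun t => Q' (u t) (u' t)) volume t₀ t₁ :=
    hcont.intervalIntegrable_of_Icc ht.le
  have hbalance : I (fun t => F' t (w' t)) = Q (u t₁) - Q (u t₀) := by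
    rw [← hscheme w' hw'V, haux u' hu'V,
      intervalIntegral.integral_eq_sub_of_hasDerivAt hderiv hint]
  have hnonneg : 0 ≤ I (-fun t => F' t (w' t)) :=
    hsign _ fun t h => neg_nonneg.mpr (hF t h)
  rw [map_neg] at hnonneg
  linarith
end

section
/- Let E be a real normed vector space and t₀ < t₁ real numbers. Let Q : E → ℝ have Fréchet derivative Q'(x) ∈ E →L[ℝ] ℝ at every x ∈ E, and let u : ℝ → E be differentiable with derivative u', such that t ↦ Q'(u(t))(u'(t)) is continuous on [t₀, t₁]. Let M : E → E → E → ℝ, let F̃ : ℝ → E → ℝ, let w̃ : ℝ → E, let V be a set of functions ℝ → E with u' ∈ V and w̃ ∈ V, and let I be a linear functional on real-valued functions of time that is sign-preserving on [t₀, t₁] (if φ(t) ≥ 0 for all t ∈ [t₀, t₁] then I[φ] ≥ 0). Assume (i) for all v ∈ V, I[t ↦ M(u(t))(u'(t))(v(t))] = I[t ↦ F̃(t)(v(t))], (ii) for all v ∈ V, I[t ↦ M(u(t))(v(t))(w̃(t))] = ∫_{t₀}^{t₁} Q'(u(t))(v(t)) dt, and (iii) F̃(t)(w̃(t)) ≥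 0 for all t ∈ [t₀, t₁]. Then Q(u(t₁)) ≥ Q(u(t₀)). -/
open MeasureTheory

theorem stmt_3
    {E : Type*} [NormedAddCommGroup E] [NormedSpace ℝ E]
    (t₀ t₁ : ℝ) (ht : t₀ < t₁)
    (Q : E → ℝ) (Q' : E → (E →L[ℝ] ℝ))
    (hQ : ∀ x : E, HasFDerivAt Q (Q' x) x)
    (u u' : ℝ → E) (hu : ∀ t : ℝ, HasDerivAt u (u' t) t)
    (hcont : ContinuousOn (fun t => Q' (u t) (u' t)) (Set.Icc t₀ t₁))
    (M : E → E → E → ℝ) (F' : ℝ → E → ℝ) (w' : ℝ → E)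
    (V : Set (ℝ → E)) (hu'V : u' ∈ V) (hw'V : w' ∈ V)
    (I : (ℝ → ℝ) →ₗ[ℝ] ℝ)
    (hsign : ∀ φ : ℝ → ℝ, (∀ t ∈ Set.Icc t₀ t₁, 0 ≤ φ t) → 0 ≤ I φ)
    (hscheme : ∀ v ∈ V,
      I (fun t => M (u t) (u' t) (v t)) = I (fun t => F' t (v t)))
    (haux : ∀ v ∈ V,
      I (fun t => M (u t) (v t) (w' t)) = ∫ t in t₀..t₁, Q' (u t) (v t))
    (hF : ∀ t ∈ Set.Icc t₀ t₁, 0 ≤ F' t (w' t)) :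
    Q (u t₀) ≤ Q (u t₁) := by
  have hftc : ∫ t in t₀..t₁, Q' (u t) (u' t) = Q (u t₁) - Q (u t₀) :=
    intervalIntegral.integral_eq_sub_of_hasDerivAt
      (fun t _ => (hQ (u t)).comp_hasDerivAt t (hu t))
      (hcont.intervalIntegrable_of_Icc ht.le)
  have hnonneg : 0 ≤ I (fun t => F' t (w' t)) := hsign _ hF
  rw [← hscheme w' hw'V, haux u' hu'V, hftc] at hnonneg
  exact sub_nonneg.mp hnonneg
end
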